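/- The center is helpless if and only if every zero-information strategy profile (s_1^r,…,s_N^r) with s_1^r,…,s_N^r ∈ S^r is an equilibrium of the competitive protocol F^c. -/

import Mathlib

open scoped Classical
noncomputable section

/-- A strategy of an agent: `(p, q)` with `p = P(mᵢ = 0 ∣ bᵢ = 0)`, `q = P(mᵢ = 0 ∣ bᵢ = 1)`. -/
abbrev Strategy : Type := (Set.Icc (0:ℝ) 1) × (Set.Icc (0:ℝ) 1)

/-- The truthful strategy `sᵗ = (1,0)`. -/
def sT : Strategy := (⟨1, by norm_num⟩, ⟨0, by norm_num⟩)

/-- A zero-information strategy: `p = q`. -/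
def ZeroInfo (s : Strategy) : Prop := (s.1 : ℝ) = (s.2 : ℝ)

/-- Vectors of `N+1` bits (bits of the center and the `N` agents; also used for
message vectors and for the center's replies).  Coordinate `0` is the center. -/
abbrev Bits (N : ℕ) : Type := Fin (N+1) → Bool

/-- A strategy profile of the `N` agents. -/
abbrev Profile (N : ℕ) : Type := Fin N → Strategy

/-- A protocol for a single agent: a map from strategy profiles and message vectors to
distributions over replies `f ∈ {0,1}^{N+1}`. -/
abbrev Protocol (N : ℕ) : Type := Profile N → Bits N → PMF (Bits N)

/-- `P(message = msg ∣ bit = bit)` under strategy `s` (where `false` plays the role of `0`). -/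
def strandP (s : Strategy) (bit msg : Bool) : ℝ :=
  if msg then 1 - (if bit then (s.2 : ℝ) else (s.1 : ℝ))
  else (if bit then (s.2 : ℝ) else (s.1 : ℝ))

/-- `P(messages = m ∣ bits = b)` under profile `s`; the center's message is her own bit. -/
def msgP {N : ℕ} (s : Profile N) (b m : Bits N) : ℝ :=
  (if m 0 = b 0 then (1:ℝ) else 0) * ∏ i : Fin N, strandP (s i) (b i.succ) (m i.succ)

/-- Joint probability of bits `b`, messages `m` and reply `f` (to the relevant agent),
under profile `s` and protocol `F`; bits are i.i.d. uniform. -/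
def jointP {N : ℕ} (s : Profile N) (F : Protocol N) (b m f : Bits N) : ℝ :=
  ((1:ℝ)/2)^(N+1) * msgP s b m * ((F s m) f).toReal

/-- `P(bᵢ = bi, mᵢ = mi, fᵢ = f, g(b) = val)` for agent `i` (coordinate `i.succ`). -/
def pObs {N : ℕ} (g : Bits N → Bool) (s : Profile N) (F : Protocol N) (i : Fin N)
    (bi mi : Bool) (f : Bits N) (val : Bool) : ℝ :=
  ∑ b : Bits N, ∑ m : Bits N,
    if b i.succ = bi ∧ m i.succ = mi ∧ g b = val then jointP s F b m f else 0

/-- `P(bᵢ = bi, mᵢ = mi, fᵢ = f)` for agent `i`. -/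
def pObsAll {N : ℕ} (s : Profile N) (F : Protocol N) (i : Fin N)
    (bi mi : Bool) (f : Bits N) : ℝ :=
  ∑ b : Bits N, ∑ m : Bits N,
    if b i.succ = bi ∧ m i.succ = mi then jointP s F b m f else 0

/-- `P(b_k = 1, bᵢ = bi, mᵢ = mi, fᵢ = f)` for agent `i`. -/
def pBit {N : ℕ} (s : Profile N) (F : Protocol N) (i : Fin N)
    (bi mi : Bool) (f : Bits N) (k : Fin (N+1)) : ℝ :=
  ∑ b : Bits N, ∑ m : Bits N,
    if b i.succ = bi ∧ m i.succ = mi ∧ b k = true then jointP s F b m f else 0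

/-- The posterior `v_k = P(b_k = 1 ∣ fᵢ, mᵢ, bᵢ)` of agent `i` at the realization
`(bi, mi, f)`. -/
def post {N : ℕ} (s : Profile N) (F : Protocol N) (i : Fin N)
    (bi mi : Bool) (f : Bits N) (k : Fin (N+1)) : ℝ :=
  pBit s F i bi mi f k / pObsAll s F i bi mi f

/-- Expected profit `V_i(s⃗; F_i)`: after observing `(bᵢ, mᵢ, fᵢ)` the agent guesses the
more likely value of `g(b)` (uniformly at random in case of a tie) and earns `c i` iff
the guess is correct. -/
def V {N : ℕ} (g : Bits N → Bool) (c : Fin N → ℝ) (s : Profile N) (F : Protocol N)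
    (i : Fin N) : ℝ :=
  c i * ∑ bi : Bool, ∑ mi : Bool, ∑ f : Bits N,
    (if pObs g s F i bi mi f true > pObs g s F i bi mi f false then pObs g s F i bi mi f true
     else if pObs g s F i bi mi f false > pObs g s F i bi mi f true then
       pObs g s F i bi mi f false
     else (pObs g s F i bi mi f false + pObs g s F i bi mi f true) / 2)

/-- Utility `U_i(s⃗; F_i) = V_i(s⃗; F_i) − priceᵢ(sᵢ)`. -/
def U {N : ℕ} (g : Bits N → Bool) (c : Fin N → ℝ) (price : Fin N → Strategy → ℝ)
    (s : Profile N) (F : Protocol N) (i : Fin N) : ℝ :=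
  V g c s F i - price i (s i)

/-- The all-truthful profile `(sᵗ, …, sᵗ)`. -/
def truthProfile (N : ℕ) : Profile N := fun _ => sT

/-- `s⃗` is an equilibrium of the protocol `F = (F_1,…,F_N)`. -/
def Equilibrium {N : ℕ} (g : Bits N → Bool) (c : Fin N → ℝ) (price : Fin N → Strategy → ℝ)
    (s : Profile N) (FF : Fin N → Protocol N) : Prop :=
  ∀ i : Fin N, ∀ s' : Strategy,
    U g c price s (FF i) i ≥ U g c price (Function.update s i s') (FF i) i

/-- The improvement `F_i⁺` of a protocol `F_i`: it agrees with `F_i` when `s_i` is a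
zero-information strategy, and otherwise returns the reply whose first coordinate is
`m₀ = b₀` and whose remaining coordinates are those of `F_i`'s reply. -/
def improve {N : ℕ} (i : Fin N) (F : Protocol N) : Protocol N := fun s m =>
  if ZeroInfo (s i) then F s m
  else PMF.map (fun f => Function.update f 0 (m 0)) (F s m)

/-- The center is helpless. -/
def Helpless (N : ℕ) (g : Bits N → Bool) (c : Fin N → ℝ)
    (price : Fin N → Strategy → ℝ) : Prop :=
  ∀ i : Fin N, ∀ F : Protocol N, ∀ si : Strategy, ¬ ZeroInfo si →
    ∀ sr : Profile N, (∀ j, ZeroInfo (sr j)) →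
      U g c price sr F i ≥ U g c price (Function.update sr i si) (improve i F) i

/-- Relative price `price_i^r(s_i) = price_i(s_i) / price_i(sᵗ)`. -/
def priceR {N : ℕ} (price : Fin N → Strategy → ℝ) (i : Fin N) (s : Strategy) : ℝ :=
  price i s / price i sT

/-- The competitive protocol (the component `F_i^c` for agent `i`). -/
def Fc {N : ℕ} (price : Fin N → Strategy → ℝ) (i : Fin N) : Protocol N := fun s m =>
  if ∀ j, s j = sT then PMF.pure m
  else if ∀ j, j ≠ i → priceR price j (s j) < priceR price i (s i) then PMF.pure m
  else PMF.uniformOfFintype (Bits N)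

/-- The protocol that always replies the full message vector `m = (b₀, m₁, …, m_N)`. -/
def Fmax (N : ℕ) : Protocol N := fun _ m => PMF.pure m

/-- The protocol that always replies `N+1` independent uniform random bits. -/
def Fmin (N : ℕ) : Protocol N := fun _ _ => PMF.uniformOfFintype (Bits N)

/-- Agent `i` is fanatic. -/
def Fanatic {N : ℕ} (g : Bits N → Bool) (c : Fin N → ℝ) (price : Fin N → Strategy → ℝ)
    (i : Fin N) : Prop :=
  ∀ s : Profile N,
    price i sT > V g c (truthProfile N) (Fmax N) i - V g c s (Fmin N) i

/-- The fair competitive protocol (the component `F_i^{fc}` for agent `i`). -/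
def Ffc {N : ℕ} (price : Fin N → Strategy → ℝ) (i : Fin N) : Protocol N := fun s m =>
  if s i = sT then PMF.pure m
  else if (∃ j, j ≠ i ∧ s j ≠ sT) ∧
      (∀ j, j ≠ i → s j ≠ sT → priceR price j (s j) < priceR price i (s i)) then PMF.pure m
  else PMF.uniformOfFintype (Bits N)

/-- `P(mᵢ = mi, fᵢ = f ∣ bits = b)` for agent `i`. -/
def obsLik {N : ℕ} (s : Profile N) (F : Protocol N) (i : Fin N) (b : Bits N) (mi : Bool)
    (f : Bits N) : ℝ :=
  ∑ m : Bits N, if m i.succ = mi then msgP s b m * ((F s m) f).toReal else 0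

/-- `P(bᵢ = bi, ψ(b) = a, g(b) = val)`. -/
def labelP {N : ℕ} {α : Type} (g : Bits N → Bool) (i : Fin N) (ψ : Bits N → α)
    (bi : Bool) (a : α) (val : Bool) : ℝ :=
  ∑ b : Bits N, if b i.succ = bi ∧ ψ b = a ∧ g b = val then ((1:ℝ)/2)^(N+1) else 0

/-- The probability of guessing `g(b)` correctly from `bᵢ` and `ψ(b)`. -/
def labelGain {N : ℕ} {α : Type} [Fintype α] (g : Bits N → Bool) (i : Fin N)
    (ψ : Bits N → α) : ℝ :=
  ∑ bi : Bool, ∑ a : α, max (labelP g i ψ bi a true) (labelP g i ψ bi a false)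

lemma strandP_nonneg (s : Strategy) (x y : Bool) : 0 ≤ strandP s x y := by
  have h1 := s.1.2.1
  have h2 := s.1.2.2
  have h3 := s.2.2.1
  have h4 := s.2.2.2
  unfold strandP
  split_ifs <;> linarith

lemma sum_strandP (s : Strategy) (x : Bool) : ∑ y, strandP s x y = 1 := by
  simp [strandP]

lemma strandP_of_zeroInfo {s : Strategy} (h : ZeroInfo s) (x x' y : Bool) :
    strandP s x y = strandP s x' y := by
  unfold ZeroInfo at h
  simp [strandP, h]

lemma msgP_nonneg {N : ℕ} (s : Profile N) (b m : Bits N) : 0 ≤ msgP s b m :=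
  mul_nonneg (by split_ifs <;> norm_num) (Finset.prod_nonneg fun _ _ => strandP_nonneg _ _ _)

lemma sum_mul_msgP {N : ℕ} (s : Profile N) (b : Bits N) (i : Fin N) (u : Bool → ℝ) :
    ∑ m, u (m i.succ) * msgP s b m = ∑ y, u y * strandP (s i) (b i.succ) y := by
  let w : Fin (N+1) → Bool → ℝ := Fin.cons (fun y => if y = b 0 then 1 else 0)
    (fun j y => (if j = i then u y else 1) * strandP (s j) (b j.succ) y)
  have key : ∀ m : Bits N, u (m i.succ) * msgP s b m = ∏ k, w k (m k) := by
    intro m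
    rw [Fin.prod_univ_succ]
    simp only [w, Fin.cons_zero, Fin.cons_succ, Finset.prod_mul_distrib, msgP]
    rw [Finset.prod_ite_eq' Finset.univ i]
    simp only [Finset.mem_univ, if_true]
    ring
  simp_rw [key]
  have hprod : ∑ m : Bits N, ∏ k, w k (m k) = ∏ k, ∑ y, w k y := by
    rw [Finset.prod_univ_sum, Fintype.piFinset_univ]
  rw [hprod, Fin.prod_univ_succ]
  simp only [w, Fin.cons_zero, Fin.cons_succ]
  rw [Finset.prod_eq_single i]
  · simp
  · intro j _ hj
    simp only [hj, if_false, one_mul, sum_strandP]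
  · simp

lemma sum_msgP {N : ℕ} (s : Profile N) (b : Bits N) (i : Fin N) : ∑ m, msgP s b m = 1 := by
  have h := sum_mul_msgP s b i fun _ => 1
  simp only [one_mul, sum_strandP] at h
  exact h

lemma PMF.sum_toReal {β : Type} [Fintype β] (p : PMF β) : ∑ x, (p x).toReal = 1 := by
  rw [← ENNReal.toReal_sum fun x _ => p.apply_ne_top x, ← tsum_fintype (L := .unconditional _),
    p.tsum_coe, ENNReal.toReal_one]

section

variable {N : ℕ} (g : Bits N → Bool) (c : Fin N → ℝ) (s : Profile N) (F : Protocol N)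
  (i : Fin N)

lemma obsLik_nonneg (b : Bits N) (mi : Bool) (f : Bits N) : 0 ≤ obsLik s F i b mi f :=
  Finset.sum_nonneg fun m _ => by
    split_ifs
    · exact mul_nonneg (msgP_nonneg _ _ _) ENNReal.toReal_nonneg
    · exact le_rfl

lemma sum_obsLik (b : Bits N) : ∑ mi, ∑ f, obsLik s F i b mi f = 1 := by
  have h : ∀ mi, ∑ f, obsLik s F i b mi f = ∑ m, if m i.succ = mi then msgP s b m else 0 := by
    intro mi
    simp only [obsLik]
    rw [Finset.sum_comm]
    refine Finset.sum_congr rfl fun m _ => ?_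
    split_ifs
    · rw [← Finset.mul_sum, PMF.sum_toReal, mul_one]
    · simp
  simp_rw [h]
  rw [Finset.sum_comm]
  simp [sum_msgP s b i]

lemma pObs_eq_sum_obsLik (bi mi : Bool) (f : Bits N) (val : Bool) :
    pObs g s F i bi mi f val =
      ∑ b, if b i.succ = bi ∧ g b = val then ((1:ℝ)/2)^(N+1) * obsLik s F i b mi f else 0 := by
  unfold pObs obsLik jointP
  refine Finset.sum_congr rfl fun b _ => ?_
  by_cases hb : b i.succ = bi ∧ g b = val
  · rw [if_pos hb, Finset.mul_sum]
    refine Finset.sum_congr rfl fun m _ => ?_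
    by_cases hm : m i.succ = mi
    · simp [hb.1, hb.2, hm, mul_assoc]
    · simp [hm]
  · rw [if_neg hb]
    exact Finset.sum_eq_zero fun m _ => if_neg fun h => hb ⟨h.1, h.2.2⟩

lemma V_eq_sum_max :
    V g c s F i = c i * ∑ bi, ∑ mi, ∑ f,
      max (pObs g s F i bi mi f true) (pObs g s F i bi mi f false) := by
  unfold V
  congr 1
  refine Finset.sum_congr rfl fun bi _ => Finset.sum_congr rfl fun mi _ =>
    Finset.sum_congr rfl fun f _ => ?_
  split_ifs with h1 h2
  · exact (max_eq_left h1.le).symm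
  · exact (max_eq_right h2.le).symm
  · have := le_antisymm (not_lt.1 h1) (not_lt.1 h2)
    rw [this]; simp

variable {g c s F i}

lemma V_congr {F' : Protocol N} (h : F s = F' s) : V g c s F i = V g c s F' i := by
  simp only [V_eq_sum_max, pObs, jointP, h]

/-- If the observation depends on the bits only through `bᵢ` and `ψ(b)`, then the agent does
no better than by observing `bᵢ` and `ψ(b)`. -/
lemma V_le_labelGain {α : Type} [Fintype α] (hc : 0 ≤ c i) (ψ : Bits N → α)
    (rep : Bool → α → Bits N)
    (h : ∀ b mi f, obsLik s F i b mi f = obsLik s F i (rep (b i.succ) (ψ b)) mi f) :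
    V g c s F i ≤ c i * labelGain g i ψ := by
  have hp : ∀ bi mi f val, pObs g s F i bi mi f val =
      ∑ a, labelP g i ψ bi a val * obsLik s F i (rep bi a) mi f := by
    intro bi mi f val
    rw [pObs_eq_sum_obsLik]
    simp only [labelP, Finset.sum_mul]
    rw [Finset.sum_comm]
    refine Finset.sum_congr rfl fun b _ => ?_
    rw [Finset.sum_eq_single (ψ b)]
    · rw [h b]
      by_cases hb : b i.succ = bi
      · subst hb
        simp
      · simp [hb]
    · intro a _ ha
      simp [ha.symm]
    · simp
  rw [V_eq_sum_max]
  refine mul_le_mul_of_nonneg_left ?_ hc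
  refine Finset.sum_le_sum fun bi _ => ?_
  calc _ ≤ ∑ mi, ∑ f, ∑ a, max (labelP g i ψ bi a true) (labelP g i ψ bi a false) *
          obsLik s F i (rep bi a) mi f := by
        refine Finset.sum_le_sum fun mi _ => Finset.sum_le_sum fun f _ => ?_
        rw [hp, hp]
        refine max_le ?_ ?_ <;> refine Finset.sum_le_sum fun a _ =>
          mul_le_mul_of_nonneg_right ?_ (obsLik_nonneg _ _ _ _ _ _)
        · exact le_max_left _ _
        · exact le_max_right _ _
    _ = ∑ a, max (labelP g i ψ bi a true) (labelP g i ψ bi a false) *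
          ∑ mi, ∑ f, obsLik s F i (rep bi a) mi f := by
        simp only [Finset.mul_sum]
        rw [Finset.sum_comm (s := (Finset.univ : Finset α))]
        exact Finset.sum_congr rfl fun mi _ => Finset.sum_comm
    _ = _ := by simp only [sum_obsLik, mul_one]

/-- If the reply reveals `ψ(b)`, then the agent does at least as well as by observing `bᵢ` and
`ψ(b)`. -/
lemma labelGain_le_V {α : Type} [Fintype α] (hc : 0 ≤ c i) (ψ : Bits N → α)
    (r : Bits N → α) (h : ∀ b mi f, obsLik s F i b mi f ≠ 0 → r f = ψ b) :
    c i * labelGain g i ψ ≤ V g c s F i := by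
  have hp : ∀ bi a val, labelP g i ψ bi a val =
      ∑ mi, ∑ f, if r f = a then pObs g s F i bi mi f val else 0 := by
    intro bi a val
    have h1 : ∀ b, (if b i.succ = bi ∧ ψ b = a ∧ g b = val then ((1:ℝ)/2)^(N+1) else 0) =
        ∑ mi, ∑ f, if r f = a then
          (if b i.succ = bi ∧ g b = val then ((1:ℝ)/2)^(N+1) * obsLik s F i b mi f else 0)
          else 0 := by
      intro b
      have h2 : ∀ mi f, (if r f = a then
          (if b i.succ = bi ∧ g b = val then ((1:ℝ)/2)^(N+1) * obsLik s F i b mi f else 0)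
          else 0) =
          (if b i.succ = bi ∧ ψ b = a ∧ g b = val then ((1:ℝ)/2)^(N+1) else 0) *
            obsLik s F i b mi f := by
        intro mi f
        by_cases h0 : obsLik s F i b mi f = 0
        · simp [h0]
        · rw [h b mi f h0]
          by_cases h3 : ψ b = a <;> simp [h3]
      simp_rw [h2, ← Finset.mul_sum, sum_obsLik, mul_one]
    unfold labelP
    simp_rw [h1]
    rw [Finset.sum_comm]
    refine Finset.sum_congr rfl fun mi _ => ?_
    rw [Finset.sum_comm]
    refine Finset.sum_congr rfl fun f _ => ?_
    split_ifs
    · rw [pObs_eq_sum_obsLik]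
    · simp
  rw [V_eq_sum_max]
  refine mul_le_mul_of_nonneg_left ?_ hc
  refine Finset.sum_le_sum fun bi _ => ?_
  calc _ ≤ ∑ a, ∑ mi, ∑ f, if r f = a then
          max (pObs g s F i bi mi f true) (pObs g s F i bi mi f false) else 0 := by
        refine Finset.sum_le_sum fun a _ => ?_
        rw [hp, hp]
        refine max_le ?_ ?_ <;> refine Finset.sum_le_sum fun mi _ =>
          Finset.sum_le_sum fun f _ => ?_ <;> split_ifs
        · exact le_max_left _ _
        · exact le_rfl
        · exact le_max_right _ _
        · exact le_rfl
    _ = _ := by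
        rw [Finset.sum_comm]
        refine Finset.sum_congr rfl fun mi _ => ?_
        rw [Finset.sum_comm]
        simp

lemma labelGain_const_le_V (hc : 0 ≤ c i) :
    c i * labelGain g i (fun _ => ()) ≤ V g c s F i :=
  labelGain_le_V hc _ (fun _ => ()) fun _ _ _ _ => rfl

lemma V_uniform_eq (hc : 0 ≤ c i) (hF : ∀ m, F s m = PMF.uniformOfFintype (Bits N)) :
    V g c s F i = c i * labelGain g i (fun _ => ()) := by
  refine le_antisymm (V_le_labelGain hc _ (fun bi _ _ => bi) fun b mi f => ?_)
    (labelGain_const_le_V hc)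
  have h : ∀ b, obsLik s F i b mi f = ∑ y, (if y = mi then
      ((PMF.uniformOfFintype (Bits N)) f).toReal else 0) * strandP (s i) (b i.succ) y := by
    intro b
    rw [← sum_mul_msgP s b i fun y => if y = mi then
      ((PMF.uniformOfFintype (Bits N)) f).toReal else 0]
    refine Finset.sum_congr rfl fun m _ => ?_
    rw [hF, ite_mul, zero_mul, mul_comm]
  rw [h, h]

lemma V_le_labelGain_center (hc : 0 ≤ c i) (hs : ∀ j, j ≠ i → ZeroInfo (s j)) :
    V g c s F i ≤ c i * labelGain g i (fun b => b 0) := by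
  refine V_le_labelGain hc _ (fun bi b0 => Function.update (fun _ => bi) 0 b0) fun b mi f => ?_
  refine Finset.sum_congr rfl fun m _ => ?_
  have : msgP s b m = msgP s (Function.update (fun _ => b i.succ) 0 (b 0)) m := by
    unfold msgP
    rw [Function.update_self]
    congr 1
    refine Finset.prod_congr rfl fun j _ => ?_
    rw [Function.update_of_ne (Fin.succ_ne_zero j)]
    by_cases hj : j = i
    · rw [hj]
    · exact strandP_of_zeroInfo (hs j hj) _ _ _
  rw [this]

lemma labelGain_center_le_V_pure (hc : 0 ≤ c i) (hF : ∀ m, F s m = PMF.pure m) :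
    c i * labelGain g i (fun b => b 0) ≤ V g c s F i := by
  refine labelGain_le_V hc _ (fun f => f 0) fun b mi f hne => ?_
  obtain ⟨m, -, hm⟩ := Finset.exists_ne_zero_of_sum_ne_zero hne
  by_contra hb
  refine hm ?_
  rw [hF]
  by_cases hfm : f = m
  · subst hfm
    simp [msgP, hb]
  · simp [PMF.pure_apply, hfm]

end

lemma not_zeroInfo_sT : ¬ ZeroInfo sT := by
  simp [ZeroInfo, sT]

section

variable {N : ℕ} {price : Fin N → Strategy → ℝ} {s : Profile N} {i : Fin N}

lemma Fc_eq_uniform (hN : 2 ≤ N) (hprice0 : ∀ i s, ZeroInfo s → price i s = 0)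
    (hs : ∀ j, ZeroInfo (s j)) (m : Bits N) :
    Fc price i s m = PMF.uniformOfFintype (Bits N) := by
  have : Nontrivial (Fin N) := Fin.nontrivial_iff_two_le.2 hN
  obtain ⟨j, hj⟩ := exists_ne i
  unfold Fc
  rw [if_neg fun h : ∀ j, s j = sT => not_zeroInfo_sT (h i ▸ hs i), if_neg]
  intro h
  have := h j hj
  simp [priceR, hprice0 _ _ (hs _)] at this

lemma Fc_eq_pure (hprice0 : ∀ i s, ZeroInfo s → price i s = 0)
    (hpricePos : ∀ i s, ¬ ZeroInfo s → 0 < price i s)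
    (hs : ∀ j, j ≠ i → ZeroInfo (s j)) (hi : ¬ ZeroInfo (s i)) (m : Bits N) :
    Fc price i s m = PMF.pure m := by
  unfold Fc
  rw [if_pos (c := ∀ j, j ≠ i → _), ite_self]
  intro j hj
  rw [priceR, hprice0 _ _ (hs j hj), zero_div]
  exact div_pos (hpricePos _ _ hi) (hpricePos _ _ not_zeroInfo_sT)

lemma improve_eq_pure {F : Protocol N} (hF : ∀ m, F s m = PMF.pure m) (m : Bits N) :
    improve i F s m = PMF.pure m := by
  unfold improve
  rw [hF, PMF.pure_map, Function.update_eq_self, ite_self]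

end

/-- helpless iff zero-information profiles are equilibria of the
competitive protocol. -/
theorem helpless_iff_zeroinfo_equilibria_Fc (N : ℕ) (hN : 2 ≤ N) (g : Bits N → Bool) (c : Fin N → ℝ)
    (hc : ∀ i, 0 < c i)
    (price : Fin N → Strategy → ℝ)
    (hpriceCont : ∀ i, Continuous (price i))
    (hprice0 : ∀ i s, ZeroInfo s → price i s = 0)
    (hpricePos : ∀ i s, ¬ ZeroInfo s → 0 < price i s)
    (hpriceMax : ∀ i s, price i s ≤ price i sT) :
    Helpless N g c price ↔
      ∀ sr : Profile N, (∀ j, ZeroInfo (sr j)) →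
        Equilibrium g c price sr (Fc price) := by
  have hupd : ∀ (sr : Profile N) (i : Fin N) (si : Strategy), (∀ j, ZeroInfo (sr j)) →
      ∀ j, j ≠ i → ZeroInfo (Function.update sr i si j) := fun sr i si hsr j hj => by
    rw [Function.update_of_ne hj]; exact hsr j
  constructor
  · intro hH sr hsr i s'
    by_cases hs' : ZeroInfo s'
    · have hall : ∀ j, ZeroInfo (Function.update sr i s' j) := fun j => by
        rcases eq_or_ne j i with rfl | hj
        · rwa [Function.update_self]
        · exact hupd sr i s' hsr j hj
      unfold U
      rw [V_uniform_eq (hc i).le (Fc_eq_uniform hN hprice0 hsr),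
        V_uniform_eq (hc i).le (Fc_eq_uniform hN hprice0 hall),
        hprice0 _ _ (hsr i), hprice0 _ _ (hall i)]
    · have hpure := Fc_eq_pure hprice0 hpricePos (hupd sr i s' hsr)
        (by rwa [Function.update_self])
      have h := hH i (Fc price i) s' hs' sr hsr
      have hV := V_congr (g := g) (c := c) (i := i)
        (funext fun m => (hpure m).trans (improve_eq_pure (i := i) hpure m).symm)
      unfold U at h ⊢
      rwa [hV]
  · intro hE i F si hsi sr hsr
    have hpure := Fc_eq_pure hprice0 hpricePos (hupd sr i si hsr)
      (by rwa [Function.update_self])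
    have h := hE sr hsr i si
    have hlow : V g c sr (Fc price i) i ≤ V g c sr F i :=
      (V_uniform_eq (hc i).le (Fc_eq_uniform hN hprice0 hsr)).trans_le
        (labelGain_const_le_V (hc i).le)
    have hupp : V g c (Function.update sr i si) (improve i F) i ≤
        V g c (Function.update sr i si) (Fc price i) i :=
      (V_le_labelGain_center (hc i).le (hupd sr i si hsr)).trans
        (labelGain_center_le_V_pure (hc i).le hpure)
    unfold U at h ⊢
    linarith

end
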